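/- Let V : ℝ → ℝ be continuous and bounded, let Λ₀ ∈ ℝ, and let ψ₀ : ℝ → ℝ be twice continuously differentiable and square-integrable with ∫_ℝ ψ₀(x)² dx = 1 and −ψ₀″(x) + V(x)ψ₀(x) = Λ₀ψ₀(x) for all x. Let ξ : ℝ → ℝ be smooth and compactly supported with ξ not identically zero, and let k ∈ ℝ. For each positive integer m define u_m(x,y) := ψ₀(x) e^{iky} ξ(y/m). Then ‖u_m‖²_{L²(ℝ²)} = m ‖ξ‖²_{L²(ℝ)}, and there exists a constant C > 0 independent of m such that ‖−Δu_m + V(x)u_m − (Λ₀ + k²)u_m‖²_{L²(ℝ²)} ≤ C/m; consequently ‖−Δu_m + Vu_m − (Λ₀+k²)u_m‖_{L²(ℝ²)} / ‖u_m‖_{L²(ℝ²)} → 0 as m → ∞. -/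

import Mathlib

open MeasureTheory Filter

/-- The Laplacian of a function on `ℝ²`, written via iterated partial derivatives. -/
noncomputable def lap (h : ℝ × ℝ → ℂ) (p : ℝ × ℝ) : ℂ :=
  deriv (deriv (fun x => h (x, p.2))) p.1 + deriv (deriv (fun y => h (p.1, y))) p.2

lemma weyl_hcs_sq {f : ℝ → ℝ} (hf : HasCompactSupport f) :
    HasCompactSupport (fun y => f y ^ 2) := by
  have h : HasCompactSupport ((fun t : ℝ => t ^ 2) ∘ f) := hf.comp_left (by norm_num)
  exact h


lemma weyl_deriv_x (ψ : ℝ → ℝ) (hψ : ContDiff ℝ 2 ψ) (c d : ℂ) :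
    deriv (deriv (fun x : ℝ => (ψ x : ℂ) * c * d)) = fun x => ((deriv (deriv ψ) x : ℝ) : ℂ) * c * d := by
  have h1 : Differentiable ℝ ψ := hψ.differentiable (by norm_num)
  have h2 : Differentiable ℝ (deriv ψ) := by
    have : ContDiff ℝ 1 (deriv ψ) := hψ.deriv' (n := 1)
    exact this.differentiable (by norm_num)
  have e1 : deriv (fun x : ℝ => (ψ x : ℂ) * c * d) = fun x => ((deriv ψ x : ℝ) : ℂ) * c * d := by
    funext x
    exact (((h1 x).hasDerivAt.ofReal_comp.mul_const c).mul_const d).deriv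
  rw [e1]
  funext x
  exact (((h2 x).hasDerivAt.ofReal_comp.mul_const c).mul_const d).deriv

lemma weyl_deriv_y (ξ : ℝ → ℝ) (hξ : ContDiff ℝ 2 ξ) (a : ℂ) (k c : ℝ) :
    deriv (deriv (fun y : ℝ => a * Complex.exp (Complex.I * k * y) * (ξ (y / c) : ℂ))) =
      fun y : ℝ => a * Complex.exp (Complex.I * k * y) *
        (-(k : ℂ) ^ 2 * (ξ (y / c) : ℂ) + 2 * Complex.I * k * ((deriv ξ (y / c) / c : ℝ) : ℂ)
          + ((deriv (deriv ξ) (y / c) / c / c : ℝ) : ℂ)) := by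
  have h1 : Differentiable ℝ ξ := hξ.differentiable (by norm_num)
  have h2 : Differentiable ℝ (deriv ξ) := by
    have : ContDiff ℝ 1 (deriv ξ) := hξ.deriv' (n := 1)
    exact this.differentiable (by norm_num)
  have hE : ∀ y : ℝ, HasDerivAt (fun y : ℝ => a * Complex.exp (Complex.I * k * y))
      (a * (Complex.exp (Complex.I * k * y) * (Complex.I * k * 1))) y := fun y =>
    (((Complex.ofRealCLM.hasDerivAt (x := y)).const_mul (Complex.I * k)).cexp).const_mul a
  have hd : ∀ y : ℝ, HasDerivAt (fun y : ℝ => y / c) (1 / c) y := fun y =>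
    (hasDerivAt_id y).div_const c
  have g1 : ∀ y : ℝ, HasDerivAt (fun y : ℝ => ((ξ (y / c) : ℝ) : ℂ))
      ((deriv ξ (y / c) * (1 / c) : ℝ) : ℂ) y := fun y =>
    (HasDerivAt.comp (h₂ := ξ) y (h1 (y / c)).hasDerivAt (hd y)).ofReal_comp
  have g2 : ∀ y : ℝ, HasDerivAt (fun y : ℝ => ((deriv ξ (y / c) : ℝ) : ℂ))
      ((deriv (deriv ξ) (y / c) * (1 / c) : ℝ) : ℂ) y := fun y =>
    (HasDerivAt.comp (h₂ := deriv ξ) y (h2 (y / c)).hasDerivAt (hd y)).ofReal_comp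
  have e1 : deriv (fun y : ℝ => a * Complex.exp (Complex.I * k * y) * (ξ (y / c) : ℂ)) =
      fun y : ℝ => a * Complex.exp (Complex.I * k * y) *
        (Complex.I * k * (ξ (y / c) : ℂ) + ((deriv ξ (y / c) : ℝ) : ℂ) * (1 / c)) := by
    funext y
    refine Eq.trans ((hE y).mul (g1 y)).deriv ?_
    push_cast
    ring
  rw [e1]
  funext y
  have := ((hE y).mul (((g1 y).const_mul (Complex.I * k)).add ((g2 y).mul_const (1 / (c : ℂ))))).deriv
  refine Eq.trans this ?_
  simp only [Pi.add_apply]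
  push_cast
  ring_nf
  simp only [Complex.I_sq]
  ring

lemma weyl_norm_sq (p k y A B : ℝ) :
    ‖(p : ℂ) * Complex.exp (Complex.I * k * y) * (2 * Complex.I * k * (A : ℂ) + (B : ℂ))‖ ^ 2
      = p ^ 2 * (4 * k ^ 2 * A ^ 2 + B ^ 2) := by
  have h1 : ‖Complex.exp (Complex.I * k * y)‖ = 1 := by
    rw [show Complex.I * k * y = ((k * y : ℝ) : ℂ) * Complex.I by push_cast; ring]
    exact Complex.norm_exp_ofReal_mul_I _
  rw [norm_mul, norm_mul, h1, mul_one, mul_pow, Complex.sq_norm, Complex.sq_norm]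
  simp [Complex.normSq_apply]
  ring

/-- Weyl sequence construction in the proof of Lemma 1: a normalized eigenfunction `ψ₀`
of `H₀ = -d²/dx² + V` at `Λ₀`, multiplied by `e^{iky} ξ(y/m)`, is an approximate
eigenfunction of `H = -Δ + V(x)` at the point `Λ₀ + k²`. -/
theorem weyl_sequence_eigenfunction
    (V : ℝ → ℝ) (hV : Continuous V) (hVb : ∃ M : ℝ, ∀ x, |V x| ≤ M)
    (Λ₀ : ℝ) (ψ₀ : ℝ → ℝ) (hψ₀ : ContDiff ℝ 2 ψ₀) (hψ₀L2 : MemLp ψ₀ 2)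
    (hnorm : ∫ x : ℝ, (ψ₀ x) ^ 2 = 1)
    (heig : ∀ x : ℝ, -deriv (deriv ψ₀) x + V x * ψ₀ x = Λ₀ * ψ₀ x)
    (ξ : ℝ → ℝ) (hξ : ContDiff ℝ (⊤ : ℕ∞) ξ) (hξc : HasCompactSupport ξ)
    (hξ0 : ξ ≠ 0) (k : ℝ)
    (u : ℕ → ℝ × ℝ → ℂ)
    (hu : ∀ m : ℕ, ∀ p : ℝ × ℝ,
      u m p = (ψ₀ p.1 : ℂ) * Complex.exp (Complex.I * k * p.2) * (ξ (p.2 / m) : ℂ)) :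
    (∀ m : ℕ, 0 < m → ∫ p : ℝ × ℝ, ‖u m p‖ ^ 2 = m * ∫ y : ℝ, (ξ y) ^ 2) ∧
    (∃ C : ℝ, 0 < C ∧ ∀ m : ℕ, 0 < m →
      ∫ p : ℝ × ℝ, ‖-lap (u m) p + V p.1 * u m p - ((Λ₀ : ℂ) + (k : ℂ) ^ 2) * u m p‖ ^ 2
        ≤ C / m) ∧
    Tendsto (fun m : ℕ =>
      Real.sqrt (∫ p : ℝ × ℝ,
          ‖-lap (u m) p + V p.1 * u m p - ((Λ₀ : ℂ) + (k : ℂ) ^ 2) * u m p‖ ^ 2) /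
        Real.sqrt (∫ p : ℝ × ℝ, ‖u m p‖ ^ 2)) atTop (nhds 0) := by
  have hξ2 : ContDiff ℝ 2 ξ := contDiff_infty.1 hξ 2
  have hd1 : Continuous (deriv ξ) := hξ2.continuous_deriv (by norm_num)
  have hd2 : Continuous (deriv (deriv ξ)) :=
    (show ContDiff ℝ 1 (deriv ξ) from hξ2.deriv' (n := 1)).continuous_deriv (by norm_num)
  have hc1 : HasCompactSupport (deriv ξ) := hξc.deriv
  have hc2 : HasCompactSupport (deriv (deriv ξ)) := hc1.deriv
  have isq : ∀ f : ℝ → ℝ, Continuous f → HasCompactSupport f →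
      Integrable (fun y => f y ^ 2) := by
    intro f hf hfc
    have hcs : HasCompactSupport (fun y => f y ^ 2) := weyl_hcs_sq hfc
    have hct : Continuous (fun y => f y ^ 2) := hf.pow 2
    exact hct.integrable_of_hasCompactSupport hcs
  have hI0 : 0 < ∫ y : ℝ, (ξ y) ^ 2 := by
    obtain ⟨y0, hy0⟩ := Function.ne_iff.1 hξ0
    have hcs : HasCompactSupport (fun y => ξ y ^ 2) := weyl_hcs_sq hξc
    have hct : Continuous (fun y => ξ y ^ 2) := hξ.continuous.pow 2
    have hnz : (fun y => ξ y ^ 2) y0 ≠ 0 := pow_ne_zero 2 hy0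
    exact hct.integral_pos_of_hasCompactSupport_nonneg_nonzero hcs (fun y => sq_nonneg _) hnz
  have key1 : ∀ m : ℕ, 0 < m → ∫ p : ℝ × ℝ, ‖u m p‖ ^ 2 = m * ∫ y : ℝ, (ξ y) ^ 2 := by
    intro m hm
    have : ∀ p : ℝ × ℝ, ‖u m p‖ ^ 2 = (ψ₀ p.1) ^ 2 * (ξ (p.2 / m)) ^ 2 := by
      intro p
      have := weyl_norm_sq (ψ₀ p.1) k p.2 0 (ξ (p.2 / m))
      rw [hu]
      simpa using this
    simp_rw [this]
    rw [Measure.volume_eq_prod,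
      integral_prod_mul (fun x => ψ₀ x ^ 2) (fun y => ξ (y / m) ^ 2), hnorm, one_mul,
      Measure.integral_comp_div (fun y => ξ y ^ 2) (m : ℝ)]
    simp
  have key2 : ∀ m : ℕ, 0 < m →
      ∫ p : ℝ × ℝ, ‖-lap (u m) p + V p.1 * u m p - ((Λ₀ : ℂ) + (k : ℂ) ^ 2) * u m p‖ ^ 2
        = (4 * k ^ 2 / m) * (∫ y, deriv ξ y ^ 2) + (1 / m ^ 3) * ∫ y, deriv (deriv ξ) y ^ 2 := by
    intro m hm
    have hm' : (m : ℝ) ≠ 0 := by positivity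
    have : ∀ p : ℝ × ℝ,
        ‖-lap (u m) p + V p.1 * u m p - ((Λ₀ : ℂ) + (k : ℂ) ^ 2) * u m p‖ ^ 2
        = (ψ₀ p.1) ^ 2 * (4 * k ^ 2 * (deriv ξ (p.2 / m) / m) ^ 2 +
            (deriv (deriv ξ) (p.2 / m) / m / m) ^ 2) := by
      intro p
      rw [← weyl_norm_sq (ψ₀ p.1) k p.2, ← norm_neg]
      congr 2
      have hx := weyl_deriv_x ψ₀ hψ₀ (Complex.exp (Complex.I * k * p.2)) (ξ (p.2 / m) : ℂ)
      have hy := weyl_deriv_y ξ hξ2 (ψ₀ p.1 : ℂ) k m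
      have he : ((deriv (deriv ψ₀) p.1 : ℝ) : ℂ) = V p.1 * ψ₀ p.1 - Λ₀ * ψ₀ p.1 := by
        have := heig p.1
        rw [show deriv (deriv ψ₀) p.1 = V p.1 * ψ₀ p.1 - Λ₀ * ψ₀ p.1 by linarith]
        push_cast
        ring
      have hux : (fun x => u m (x, p.2)) = fun x : ℝ =>
          (ψ₀ x : ℂ) * Complex.exp (Complex.I * k * p.2) * (ξ (p.2 / m) : ℂ) := by
        funext x; rw [hu]
      have huy : (fun y => u m (p.1, y)) = fun y : ℝ =>
          (ψ₀ p.1 : ℂ) * Complex.exp (Complex.I * k * y) * (ξ (y / (m : ℝ)) : ℂ) := by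
        funext y; rw [hu]
      rw [lap, hux, huy, hx, hy, hu]
      simp only [he]
      ring
    simp_rw [this]
    rw [Measure.volume_eq_prod,
      integral_prod_mul (fun x => ψ₀ x ^ 2) (fun y => (4 * k ^ 2 * (deriv ξ (y / m) / m) ^ 2 +
            (deriv (deriv ξ) (y / m) / m / m) ^ 2)), hnorm, one_mul,
      Measure.integral_comp_div (fun y => 4 * k ^ 2 * (deriv ξ y / m) ^ 2 +
            (deriv (deriv ξ) y / m / m) ^ 2) (m : ℝ)]
    have e : ∀ y, 4 * k ^ 2 * (deriv ξ y / m) ^ 2 + (deriv (deriv ξ) y / m / m) ^ 2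
        = (4 * k ^ 2 / m ^ 2) * deriv ξ y ^ 2 + (1 / m ^ 4) * deriv (deriv ξ) y ^ 2 := by
      intro y
      field_simp
    simp_rw [e]
    rw [integral_add ((isq _ hd1 hc1).const_mul _) ((isq _ hd2 hc2).const_mul _),
      integral_const_mul, integral_const_mul, smul_eq_mul, abs_of_nonneg (by positivity)]
    field_simp
  have hA : 0 ≤ ∫ y, deriv ξ y ^ 2 := integral_nonneg fun y => sq_nonneg _
  have hB : 0 ≤ ∫ y, deriv (deriv ξ) y ^ 2 := integral_nonneg fun y => sq_nonneg _
  have key3 : ∃ C : ℝ, 0 < C ∧ ∀ m : ℕ, 0 < m →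
      ∫ p : ℝ × ℝ, ‖-lap (u m) p + V p.1 * u m p - ((Λ₀ : ℂ) + (k : ℂ) ^ 2) * u m p‖ ^ 2
        ≤ C / m := by
    refine ⟨4 * k ^ 2 * (∫ y, deriv ξ y ^ 2) + (∫ y, deriv (deriv ξ) y ^ 2) + 1,
      by positivity, fun m hm => ?_⟩
    rw [key2 m hm]
    have hm1 : (1 : ℝ) ≤ m := by exact_mod_cast hm
    have h3 : (1 : ℝ) / m ^ 3 ≤ 1 / m :=
      one_div_le_one_div_of_le (by positivity) (le_self_pow₀ hm1 (by norm_num))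
    have h4 := mul_le_mul_of_nonneg_right h3 hB
    have h5 : (0 : ℝ) ≤ 1 / m := by positivity
    have h6 : (4 * k ^ 2 * (∫ y, deriv ξ y ^ 2) + (∫ y, deriv (deriv ξ) y ^ 2) + 1) / (m : ℝ)
      = (4 * k ^ 2 / m) * (∫ y, deriv ξ y ^ 2) + 1 / m * (∫ y, deriv (deriv ξ) y ^ 2) + 1 / m := by
      ring
    rw [h6]
    linarith
  refine ⟨key1, key3, ?_⟩
  obtain ⟨C, hC, hCm⟩ := key3
  have hlim : Tendsto (fun m : ℕ => Real.sqrt (C / ∫ y : ℝ, (ξ y) ^ 2) / (m : ℝ)) atTop (nhds 0) :=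
    tendsto_const_div_atTop_nhds_zero_nat _
  refine squeeze_zero' (Eventually.of_forall fun m => by positivity) ?_ hlim
  filter_upwards [eventually_gt_atTop 0] with m hm
  have hm0 : (0 : ℝ) < m := by exact_mod_cast hm
  rw [key1 m hm, ← Real.sqrt_div' _ (by positivity)]
  apply Real.sqrt_le_iff.2
  refine ⟨by positivity, ?_⟩
  rw [div_pow, Real.sq_sqrt (by positivity), div_le_iff₀ (by positivity)]
  refine (hCm m hm).trans (le_of_eq ?_)
  field_simp
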